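/- arXiv:2408.03116 — 2 statements merged into one kernel-verified Lean document; each statement's English description precedes it below -/
import Mathlib

section
/- (Lemma 1, second inequality.) With F₁, F₂, f₁, f₂, v₁*, v₂*, p₂ and s²₁ as in the hazard-rate-ordered setup, and p₀ = ∫₀¹∫₀¹ min(v₁, v₂) f₁(v₁) f₂(v₂) dv₁ dv₂, we have p₂ − s²₁ > p₀; that is, builder 2's willingness to pay in the execution auction strictly exceeds the expected second-price-auction revenue that a non-builder owner would obtain. -/
open MeasureTheory Set

/-- A function continuous on `[0,1]` and positive on `(0,1)` is nonnegative on `[0,1]`. -/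
lemma nonneg_on_Icc_of_pos_on_Ioo {f : ℝ → ℝ} (hf : ContinuousOn f (Icc 0 1))
    (hpos : ∀ v ∈ Ioo (0:ℝ) 1, 0 < f v) : ∀ v ∈ Icc (0:ℝ) 1, 0 ≤ f v := by
  have hcl : closure (Ioo (0:ℝ) 1) = Icc 0 1 := closure_Ioo zero_ne_one
  intro v hv
  exact le_on_closure (f := fun _ => (0:ℝ)) (fun x hx => (hpos x hx).le)
    continuousOn_const (hcl ▸ hf) (hcl ▸ hv)

/-- A CDF whose density is continuous on `[0,1]` and positive on `(0,1)` is strictly increasing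
on `[0,1]`. -/
lemma cdf_strictMonoOn {F f : ℝ → ℝ} (hf : ContinuousOn f (Icc 0 1))
    (hpos : ∀ v ∈ Ioo (0:ℝ) 1, 0 < f v)
    (hF : ∀ v ∈ Icc (0:ℝ) 1, F v = ∫ t in (0:ℝ)..v, f t) : StrictMonoOn F (Icc 0 1) := by
  intro a ha b hb hab
  have hint : ∀ x ∈ Icc (0:ℝ) 1, ∀ y ∈ Icc (0:ℝ) 1, IntervalIntegrable f volume x y :=
    fun x hx y hy => (hf.mono (uIcc_subset_Icc hx hy)).intervalIntegrable
  have h0 : (0:ℝ) ∈ Icc (0:ℝ) 1 := ⟨le_rfl, zero_le_one⟩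
  have hsub := intervalIntegral.integral_interval_sub_left (hint 0 h0 b hb) (hint 0 h0 a ha)
  have hgt := intervalIntegral.intervalIntegral_pos_of_pos_on (hint a ha b hb)
    (fun x hx => hpos x ⟨ha.1.trans_lt hx.1, hx.2.trans_le hb.2⟩) hab
  rw [hF a ha, hF b hb]
  linarith

/-- A right inverse of a strictly increasing virtual value function is increasing. -/
lemma virtualValue_inverse_monotoneOn {φ w : ℝ → ℝ} (hφ : StrictMonoOn φ (Icc 0 1))
    (hw : ∀ x ∈ Icc (0:ℝ) 1, w x ∈ Icc (0:ℝ) 1 ∧ φ (w x) = x) : MonotoneOn w (Icc 0 1) := by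
  intro a ha b hb hab
  rw [← hφ.le_iff_le (hw a ha).1 (hw b hb).1, (hw a ha).2, (hw b hb).2]
  exact hab

/-- The optimal resale price is at least the seller's own value. -/
lemma le_virtualValue_inverse {F f w : ℝ → ℝ} (hF1 : F 1 = 1)
    (hf : ∀ v ∈ Icc (0:ℝ) 1, 0 ≤ f v) (hF : StrictMonoOn F (Icc 0 1))
    (hw : ∀ x ∈ Icc (0:ℝ) 1, w x ∈ Icc (0:ℝ) 1 ∧ w x - (1 - F (w x)) / f (w x) = x) :
    ∀ x ∈ Icc (0:ℝ) 1, x ≤ w x := by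
  intro x hx
  obtain ⟨hmem, heq⟩ := hw x hx
  have hle := hF.monotoneOn hmem (right_mem_Icc.2 zero_le_one) hmem.2
  have := div_nonneg (show 0 ≤ 1 - F (w x) by linarith) (hf _ hmem)
  linarith

/-- For an interior seller's value the optimal resale price lies strictly between the value
and one. -/
lemma virtualValue_inverse_mem_Ioo {F f w : ℝ → ℝ} (hF1 : F 1 = 1)
    (hf : ∀ v ∈ Icc (0:ℝ) 1, 0 ≤ f v) (hpos : ∀ v ∈ Ioo (0:ℝ) 1, 0 < f v)
    (hF : StrictMonoOn F (Icc 0 1))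
    (hw : ∀ x ∈ Icc (0:ℝ) 1, w x ∈ Icc (0:ℝ) 1 ∧ w x - (1 - F (w x)) / f (w x) = x) :
    ∀ x ∈ Ioo (0:ℝ) 1, w x ∈ Ioo x 1 := by
  intro x hx
  have hx' := Ioo_subset_Icc_self hx
  obtain ⟨hmem, heq⟩ := hw x hx'
  have hle := le_virtualValue_inverse hF1 hf hF hw x hx'
  have hlt : w x < 1 := by
    refine lt_of_le_of_ne hmem.2 fun h => ?_
    rw [h, hF1] at heq
    norm_num at heq
    exact hx.2.ne heq.symm
  have hFlt := hF hmem (right_mem_Icc.2 zero_le_one) hlt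
  have := div_pos (show 0 < 1 - F (w x) by linarith) (hpos _ ⟨hx.1.trans_le hle, hlt⟩)
  exact ⟨by linarith, hlt⟩

/-- Lemma 1, second inequality: `p₂ - s²₁ > p₀`, builder 2's willingness to pay exceeds a non-builder owner's expected second-price resale revenue `p₀ = E[min(v₁,v₂)]`. -/
theorem lemma1_second_inequality
    (F₁ F₂ f₁ f₂ v₁s v₂s : ℝ → ℝ)
    (hF₁0 : F₁ 0 = 0) (hF₁1 : F₁ 1 = 1) (hF₂0 : F₂ 0 = 0) (hF₂1 : F₂ 1 = 1)
    (hf₁cont : ContinuousOn f₁ (Icc 0 1)) (hf₂cont : ContinuousOn f₂ (Icc 0 1))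
    (hf₁pos : ∀ v ∈ Ioo (0:ℝ) 1, 0 < f₁ v) (hf₂pos : ∀ v ∈ Ioo (0:ℝ) 1, 0 < f₂ v)
    (hF₁d : ∀ v ∈ Icc (0:ℝ) 1, F₁ v = ∫ t in (0:ℝ)..v, f₁ t)
    (hF₂d : ∀ v ∈ Icc (0:ℝ) 1, F₂ v = ∫ t in (0:ℝ)..v, f₂ t)
    (hhaz₁ : ∀ a ∈ Icc (0:ℝ) 1, ∀ b ∈ Icc (0:ℝ) 1, a ≤ b → F₁ a < 1 → F₁ b < 1 →
      f₁ a / (1 - F₁ a) ≤ f₁ b / (1 - F₁ b))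
    (hhaz₂ : ∀ a ∈ Icc (0:ℝ) 1, ∀ b ∈ Icc (0:ℝ) 1, a ≤ b → F₂ a < 1 → F₂ b < 1 →
      f₂ a / (1 - F₂ a) ≤ f₂ b / (1 - F₂ b))
    (hdom : ∀ v ∈ Icc (0:ℝ) 1, F₁ v < 1 → F₂ v < 1 →
      f₁ v / (1 - F₁ v) ≤ f₂ v / (1 - F₂ v))
    (hφ₁cont : ContinuousOn (fun v => v - (1 - F₁ v) / f₁ v) (Icc 0 1))
    (hφ₂cont : ContinuousOn (fun v => v - (1 - F₂ v) / f₂ v) (Icc 0 1))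
    (hφ₁mono : StrictMonoOn (fun v => v - (1 - F₁ v) / f₁ v) (Icc 0 1))
    (hφ₂mono : StrictMonoOn (fun v => v - (1 - F₂ v) / f₂ v) (Icc 0 1))
    (hφ₁0 : (0:ℝ) - (1 - F₁ 0) / f₁ 0 ≤ 0) (hφ₁1 : (1:ℝ) - (1 - F₁ 1) / f₁ 1 = 1)
    (hφ₂0 : (0:ℝ) - (1 - F₂ 0) / f₂ 0 ≤ 0) (hφ₂1 : (1:ℝ) - (1 - F₂ 1) / f₂ 1 = 1)
    (hv₁s : ∀ x ∈ Icc (0:ℝ) 1, v₁s x ∈ Icc (0:ℝ) 1 ∧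
      v₁s x - (1 - F₁ (v₁s x)) / f₁ (v₁s x) = x)
    (hv₂s : ∀ x ∈ Icc (0:ℝ) 1, v₂s x ∈ Icc (0:ℝ) 1 ∧
      v₂s x - (1 - F₂ (v₂s x)) / f₂ (v₂s x) = x) :
    (∫ v in (0:ℝ)..1, (v₁s v * (1 - F₁ (v₁s v)) + v * F₁ (v₁s v)) * f₂ v)
      - (∫ v₂ in (0:ℝ)..1, ∫ v₁ in (0:ℝ)..1, max (v₂ - v₂s v₁) 0 * (f₁ v₁ * f₂ v₂))
      > (∫ v₂ in (0:ℝ)..1, ∫ v₁ in (0:ℝ)..1, min v₁ v₂ * (f₁ v₁ * f₂ v₂)) := by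
  have h0 : (0:ℝ) ∈ Icc (0:ℝ) 1 := ⟨le_rfl, zero_le_one⟩
  have h1 : (1:ℝ) ∈ Icc (0:ℝ) 1 := ⟨zero_le_one, le_rfl⟩
  have hU : uIcc (0:ℝ) 1 = Icc 0 1 := uIcc_of_le zero_le_one
  have hf₁nn := nonneg_on_Icc_of_pos_on_Ioo hf₁cont hf₁pos
  have hf₂nn := nonneg_on_Icc_of_pos_on_Ioo hf₂cont hf₂pos
  have hF₁m := cdf_strictMonoOn hf₁cont hf₁pos hF₁d
  have hF₂m := cdf_strictMonoOn hf₂cont hf₂pos hF₂d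
  have hw₁m := virtualValue_inverse_monotoneOn hφ₁mono hv₁s
  have hw₂m := virtualValue_inverse_monotoneOn hφ₂mono hv₂s
  have hw₂le := le_virtualValue_inverse hF₂1 hf₂nn hF₂m hv₂s
  have hw₁gt := virtualValue_inverse_mem_Ioo hF₁1 hf₁nn hf₁pos hF₁m hv₁s
  have hf₁U : ContinuousOn f₁ (uIcc 0 1) := hU ▸ hf₁cont
  have hf₂U : ContinuousOn f₂ (uIcc 0 1) := hU ▸ hf₂cont
  have hFw : MonotoneOn (fun v => F₁ (v₁s v)) (Icc 0 1) := fun a ha b hb hab =>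
    hF₁m.monotoneOn (hv₁s a ha).1 (hv₁s b hb).1 (hw₁m ha hb hab)
  have hFw0 : ∀ v ∈ Icc (0:ℝ) 1, 0 ≤ F₁ (v₁s v) := fun v hv =>
    hF₁0 ▸ hF₁m.monotoneOn h0 (hv₁s v hv).1 (hv₁s v hv).1.1
  have hwF : MonotoneOn (fun v => v₁s v * F₁ (v₁s v)) (Icc 0 1) := fun a ha b hb hab =>
    mul_le_mul (hw₁m ha hb hab) (hFw ha hb hab) (hFw0 a ha) (hv₁s b hb).1.1
  have hidF : MonotoneOn (fun v => v * F₁ (v₁s v)) (Icc 0 1) := fun a ha b hb hab =>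
    mul_le_mul hab (hFw ha hb hab) (hFw0 a ha) hb.1
  have hmono : ∀ {g : ℝ → ℝ}, MonotoneOn g (Icc 0 1) → IntervalIntegrable g volume 0 1 :=
    fun hg => MonotoneOn.intervalIntegrable (hU ▸ hg)
  have hIp : IntervalIntegrable
      (fun v => (v₁s v * (1 - F₁ (v₁s v)) + v * F₁ (v₁s v)) * f₂ v) volume 0 1 := by
    refine IntervalIntegrable.mul_continuousOn ?_ hf₂U
    convert ((hmono hw₁m).sub (hmono hwF)).add (hmono hidF) using 1
    ext v
    ring
  have hIs : ∀ v, IntervalIntegrable (fun u => max (v - v₂s u) 0 * f₁ u) volume 0 1 := by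
    intro v
    refine IntervalIntegrable.mul_continuousOn (AntitoneOn.intervalIntegrable ?_) hf₁U
    rw [hU]
    intro a ha b hb hab
    exact max_le_max (sub_le_sub_left (hw₂m ha hb hab) v) le_rfl
  have hIm : ∀ v, IntervalIntegrable (fun u => min u v * f₁ u) volume 0 1 := fun v =>
    IntervalIntegrable.mul_continuousOn
      (continuous_id.min continuous_const).continuousOn.intervalIntegrable hf₁U
  have hs_mono : Monotone (fun v => ∫ u in (0:ℝ)..1, max (v - v₂s u) 0 * f₁ u) := by
    intro a b hab
    refine intervalIntegral.integral_mono_on zero_le_one (hIs a) (hIs b) fun u hu => ?_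
    exact mul_le_mul_of_nonneg_right (max_le_max (sub_le_sub_right hab _) le_rfl) (hf₁nn u hu)
  have hm_mono : Monotone (fun v => ∫ u in (0:ℝ)..1, min u v * f₁ u) := by
    intro a b hab
    refine intervalIntegral.integral_mono_on zero_le_one (hIm a) (hIm b) fun u hu => ?_
    exact mul_le_mul_of_nonneg_right (min_le_min le_rfl hab) (hf₁nn u hu)
  have hIS := (hmono (hs_mono.monotoneOn _)).mul_continuousOn hf₂U
  have hIM := (hmono (hm_mono.monotoneOn _)).mul_continuousOn hf₂U
  have hinner : ∀ v, (∫ u in (0:ℝ)..1, max (v - v₂s u) 0 * f₁ u)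
      + (∫ u in (0:ℝ)..1, min u v * f₁ u) ≤ v := by
    intro v
    have hv : ∫ u in (0:ℝ)..1, v * f₁ u = v := by
      rw [intervalIntegral.integral_const_mul, ← hF₁d 1 h1, hF₁1, mul_one]
    rw [← intervalIntegral.integral_add (hIs v) (hIm v)]
    refine (intervalIntegral.integral_mono_on zero_le_one ((hIs v).add (hIm v))
      (hf₁U.intervalIntegrable.const_mul v) fun u hu => ?_).trans_eq hv
    rw [← add_mul]
    refine mul_le_mul_of_nonneg_right ?_ (hf₁nn u hu)
    have := hw₂le u hu
    rcases le_total (v - v₂s u) 0 with h | h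
    · rw [max_eq_right h, zero_add]
      exact min_le_right _ _
    · rw [max_eq_left h]
      linarith [min_le_left u v]
  simp_rw [← mul_assoc, intervalIntegral.integral_mul_const]
  rw [gt_iff_lt, ← sub_pos, ← intervalIntegral.integral_sub hIp hIS,
    ← intervalIntegral.integral_sub (hIp.sub hIS) hIM]
  refine intervalIntegral.intervalIntegral_pos_of_pos_on ((hIp.sub hIS).sub hIM)
    (fun v hv => ?_) zero_lt_one
  rw [← sub_mul, ← sub_mul]
  refine mul_pos ?_ (hf₂pos v hv)
  have hFlt := hF₁m (hv₁s v (Ioo_subset_Icc_self hv)).1 h1 (hw₁gt v hv).2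
  rw [hF₁1] at hFlt
  nlinarith [hinner v, mul_pos (sub_pos.2 (hw₁gt v hv).1) (sub_pos.2 hFlt)]
end

section
/- (Corollary to Theorem 1.) Let f₁, f₂ be densities on [0,1], positive on (0,1), and let v₂* : [0,1] → [0,1] be measurable with v₂*(x) ≥ x for all x and v₂*(x) > x for all x ∈ (0,1). Then ∫₀¹∫₀¹ 1{v₂ ≥ v₂*(v₁)} f₁(v₁) f₂(v₂) dv₂ dv₁ < ∫₀¹∫₀¹ 1{v₂ ≥ v₁} f₁(v₁) f₂(v₂) dv₂ dv₁. That is, when builder 1 owns the proposal right and offers it to builder 2 at the price v₂*(v₁) > v₁, builder 2 proposes the block with strictly lower probability than under a just-in-time English auction, in which builder 2 proposes whenever v₂ ≥ v₁. -/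
open MeasureTheory Set

/-- A measurable function times an upper-tail indicator is interval integrable if the function is. -/
lemma intervalIntegrable_ite_le_mul {f : ℝ → ℝ} {l u : ℝ}
    (hf : IntervalIntegrable f volume l u) (a : ℝ) :
    IntervalIntegrable (fun y => (if a ≤ y then (1:ℝ) else 0) * f y) volume l u := by
  have hm : Measurable fun y : ℝ => if a ≤ y then (1:ℝ) else 0 :=
    Measurable.ite measurableSet_Ici measurable_const measurable_const
  refine hf.mono_fun (hm.aestronglyMeasurable.mul hf.def'.aestronglyMeasurable) ?_
  refine Filter.Eventually.of_forall fun y => ?_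
  by_cases h : a ≤ y <;> simp [h]

/-- Integrating against an upper-tail indicator truncates the interval of integration. -/
lemma intervalIntegral_ite_le_mul {f : ℝ → ℝ} {l u a : ℝ}
    (hf : IntervalIntegrable f volume l u) (ha : a ∈ Icc l u) :
    (∫ y in l..u, (if a ≤ y then (1:ℝ) else 0) * f y) = ∫ y in a..u, f y := by
  have hi := intervalIntegrable_ite_le_mul hf a
  have hlu : l ≤ u := ha.1.trans ha.2
  have ha' : a ∈ uIcc l u := by rwa [uIcc_of_le hlu]
  rw [← intervalIntegral.integral_add_adjacent_intervals
    (hi.mono_set (uIcc_subset_uIcc_left ha')) (hi.mono_set (uIcc_subset_uIcc_right ha'))]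
  have h₁ : (∫ y in l..a, (if a ≤ y then (1:ℝ) else 0) * f y) = 0 := by
    refine intervalIntegral.integral_zero_ae ?_
    filter_upwards [compl_mem_ae_iff.mpr (measure_singleton (μ := volume) a)] with y hy hmem
    rw [uIoc_of_le ha.1] at hmem
    simp [not_le.mpr (lt_of_le_of_ne hmem.2 hy)]
  have h₂ : (∫ y in a..u, (if a ≤ y then (1:ℝ) else 0) * f y) = ∫ y in a..u, f y := by
    refine intervalIntegral.integral_congr fun y hy => ?_
    rw [uIcc_of_le ha.2] at hy
    simp [hy.1]
  rw [h₁, h₂, zero_add]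

/-- The upper-tail integral of a nonnegative function is antitone in the cutoff. -/
lemma antitone_intervalIntegral_ite_le_mul {f : ℝ → ℝ} {l u : ℝ} (hlu : l ≤ u)
    (hf : IntervalIntegrable f volume l u) (hf0 : ∀ x, 0 ≤ f x) :
    Antitone fun a => ∫ y in l..u, (if a ≤ y then (1:ℝ) else 0) * f y := by
  intro a b hab
  refine intervalIntegral.integral_mono_on hlu (intervalIntegrable_ite_le_mul hf b)
    (intervalIntegrable_ite_le_mul hf a) fun y _ => ?_
  refine mul_le_mul_of_nonneg_right ?_ (hf0 y)
  split_ifs with hb ha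
  · exact le_rfl
  · exact absurd (hab.trans hb) ha
  · exact zero_le_one
  · exact le_rfl

/-- Corollary to Theorem 1: with densities `f₁, f₂` on `[0,1]` positive
on `(0,1)` and a measurable markup function `v₂s` with `v₂s x ≥ x` everywhere and
`v₂s x > x` on `(0,1)`, builder 2 obtains the block strictly less often under the
execution-auction resale (accepting iff `v₂ ≥ v₂s v₁`) than under a just-in-time
English auction (winning iff `v₂ ≥ v₁`). -/
theorem builder2_proposes_less_often
    (f₁ f₂ v₂s : ℝ → ℝ)
    (hf₁m : Measurable f₁) (hf₂m : Measurable f₂) (hv₂sm : Measurable v₂s)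
    (hf₁nonneg : ∀ x, 0 ≤ f₁ x) (hf₂nonneg : ∀ x, 0 ≤ f₂ x)
    (hf₁pos : ∀ x ∈ Ioo (0:ℝ) 1, 0 < f₁ x) (hf₂pos : ∀ x ∈ Ioo (0:ℝ) 1, 0 < f₂ x)
    (hf₁int : (∫ x in (0:ℝ)..1, f₁ x) = 1) (hf₂int : (∫ x in (0:ℝ)..1, f₂ x) = 1)
    (hv₂smem : ∀ x ∈ Icc (0:ℝ) 1, v₂s x ∈ Icc (0:ℝ) 1)
    (hv₂sge : ∀ x, x ≤ v₂s x)
    (hv₂sgt : ∀ x ∈ Ioo (0:ℝ) 1, x < v₂s x) :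
    (∫ v₁ in (0:ℝ)..1, ∫ v₂ in (0:ℝ)..1,
        (if v₂s v₁ ≤ v₂ then (1:ℝ) else 0) * (f₁ v₁ * f₂ v₂))
      < ∫ v₁ in (0:ℝ)..1, ∫ v₂ in (0:ℝ)..1,
        (if v₁ ≤ v₂ then (1:ℝ) else 0) * (f₁ v₁ * f₂ v₂) := by
  have hi₁ : IntervalIntegrable f₁ volume 0 1 := by
    by_contra h
    exact zero_ne_one ((intervalIntegral.integral_undef h).symm.trans hf₁int)
  have hi₂ : IntervalIntegrable f₂ volume 0 1 := by
    by_contra h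
    exact zero_ne_one ((intervalIntegral.integral_undef h).symm.trans hf₂int)
  set T : ℝ → ℝ := fun a => ∫ y in (0:ℝ)..1, (if a ≤ y then (1:ℝ) else 0) * f₂ y with hT
  have hTm : Measurable T :=
    (antitone_intervalIntegral_ite_le_mul zero_le_one hi₂ hf₂nonneg).measurable
  have hT0 : ∀ a, 0 ≤ T a := fun a =>
    intervalIntegral.integral_nonneg zero_le_one fun y _ =>
      mul_nonneg (by split_ifs <;> norm_num) (hf₂nonneg y)
  have hT1 : ∀ a, T a ≤ 1 := fun a => by
    rw [← hf₂int]
    refine intervalIntegral.integral_mono_on zero_le_one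
      (intervalIntegrable_ite_le_mul hi₂ a) hi₂ fun y _ => ?_
    exact mul_le_of_le_one_left (hf₂nonneg y) (by split_ifs <;> norm_num)
  have hinner : ∀ a x, (∫ y in (0:ℝ)..1, (if a ≤ y then (1:ℝ) else 0) * (f₁ x * f₂ y))
      = f₁ x * T a := fun a x => by
    rw [hT, ← intervalIntegral.integral_const_mul]
    simp only [mul_left_comm]
  have hint : ∀ g : ℝ → ℝ, Measurable g →
      IntervalIntegrable (fun x => f₁ x * T (g x)) volume 0 1 := fun g hg => by
    refine hi₁.mono_fun (hf₁m.mul (hTm.comp hg)).aestronglyMeasurable ?_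
    refine Filter.Eventually.of_forall fun x => ?_
    dsimp only
    rw [norm_mul, Real.norm_of_nonneg (hT0 _)]
    exact mul_le_of_le_one_right (norm_nonneg _) (hT1 _)
  have hlt : ∀ x ∈ Ioo (0:ℝ) 1, T (v₂s x) < T x := fun x hx => by
    have hxI : x ∈ Icc (0:ℝ) 1 := Ioo_subset_Icc_self hx
    have hv := hv₂smem x hxI
    have hu : (1:ℝ) ∈ uIcc (0:ℝ) 1 := right_mem_uIcc
    have hx' : x ∈ uIcc (0:ℝ) 1 := by rwa [uIcc_of_le zero_le_one]
    have hv' : v₂s x ∈ uIcc (0:ℝ) 1 := by rwa [uIcc_of_le zero_le_one]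
    have hxv := hi₂.mono_set (uIcc_subset_uIcc hx' hv')
    have hpos : 0 < ∫ y in x..v₂s x, f₂ y :=
      intervalIntegral.intervalIntegral_pos_of_pos_on hxv
        (fun y hy => hf₂pos y ⟨hx.1.trans hy.1, hy.2.trans_le hv.2⟩) (hv₂sgt x hx)
    have hadd := intervalIntegral.integral_add_adjacent_intervals hxv
      (hi₂.mono_set (uIcc_subset_uIcc hv' hu))
    rw [hT]
    dsimp only
    rw [intervalIntegral_ite_le_mul hi₂ hv, intervalIntegral_ite_le_mul hi₂ hxI]
    linarith
  simp only [hinner]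
  have hid : IntervalIntegrable (fun x => f₁ x * T x) volume 0 1 := hint _ measurable_id
  rw [← sub_pos, ← intervalIntegral.integral_sub hid (hint _ hv₂sm)]
  refine intervalIntegral.intervalIntegral_pos_of_pos_on
    (hid.sub (hint _ hv₂sm)) (fun x hx => ?_) zero_lt_one
  exact sub_pos.mpr (mul_lt_mul_of_pos_left (hlt x hx) (hf₁pos x hx))
end
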